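/- arXiv:2306.03712 — 2 statements merged into one kernel-verified Lean document; each statement's English description precedes it below -/
import Mathlib

section
/- Let E ⊂ ℝ² be a bounded smooth domain, T̃ > 0, α ∈ (0,1). Let z ∈ C⁰([0,T̃]; C^{1,α}(cl(E);ℝ²)) be divergence-free and tangential at ∂E, g ∈ L^∞((0,T̃); C^{0,α}(cl(E);ℝ²)), and H₀ ∈ C^{1,α}(cl(E);ℝ²). Suppose H ∈ C⁰([0,T̃]; C^{1,α}(cl(E);ℝ²)) solves ∂_t H + (z·∇)H − (H·∇)z = g in E×(0,T̃) with H(·,0) = H₀. Then for every t ∈ [0,T̃], supp(H(·,t)) ⊆ Z(supp(H₀), 0, t) ∪ ⋃_{s∈[0,t]} Z(supp(g(·,s)), s, t), where Z is the flow of z, i.e. d/dt Z(x,s,t) = z(Z(x,s,t),t), Z(x,s,s) = x. -/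
open Set Filter MeasureTheory Topology

noncomputable section

/-- Points of the plane. -/
abbrev V2 : Type := Fin 2 → ℝ

/-- Standard basis vectors of the plane. -/
def ebasis (i : Fin 2) : V2 := Pi.single i 1

/-- Euclidean dot product. -/
def dot (a b : V2) : ℝ := ∑ i, a i * b i

/-- Divergence of a planar vector field. -/
def div2 (f : V2 → V2) (x : V2) : ℝ := ∑ i, fderiv ℝ f x (ebasis i) i

/-- Planar curl `∂₁ f₂ - ∂₂ f₁`. -/
def curl2 (f : V2 → V2) (x : V2) : ℝ :=
  fderiv ℝ f x (ebasis 0) 1 - fderiv ℝ f x (ebasis 1) 0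

/-- Gradient of a scalar field. -/
def grad2 (p : V2 → ℝ) (x : V2) : V2 := fun i => fderiv ℝ p x (ebasis i)

/-- Perpendicular gradient `∇⊥ φ = (∂₂ φ, -∂₁ φ)`. -/
def gradPerp (φ : V2 → ℝ) (x : V2) : V2 :=
  ![fderiv ℝ φ x (ebasis 1), -fderiv ℝ φ x (ebasis 0)]

/-- Laplacian of a scalar field. -/
def lap2 (q : V2 → ℝ) (x : V2) : ℝ :=
  ∑ i, fderiv ℝ (fun y => fderiv ℝ q y (ebasis i)) x (ebasis i)

/-- Hölder norm `‖f‖_{m,α,E}`. -/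
def hNorm {F : Type*} [NormedAddCommGroup F] [NormedSpace ℝ F]
    (m : ℕ) (α : ℝ) (E : Set V2) (f : V2 → F) : ℝ :=
  (∑ k ∈ Finset.range (m + 1), ⨆ x ∈ E, ‖iteratedFDeriv ℝ k f x‖) +
    ⨆ x ∈ E, ⨆ y ∈ E,
      ‖iteratedFDeriv ℝ m f x - iteratedFDeriv ℝ m f y‖ / ‖x - y‖ ^ α

/-- Membership in the Hölder class `C^{m,α}(E; F)`. -/
def HolderClass {F : Type*} [NormedAddCommGroup F] [NormedSpace ℝ F]
    (m : ℕ) (α : ℝ) (E : Set V2) (f : V2 → F) : Prop :=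
  ContDiff ℝ m f ∧
    ∃ C : ℝ, (∀ k ≤ m, ∀ x ∈ E, ‖iteratedFDeriv ℝ k f x‖ ≤ C) ∧
      ∀ x ∈ E, ∀ y ∈ E,
        ‖iteratedFDeriv ℝ m f x - iteratedFDeriv ℝ m f y‖ ≤ C * ‖x - y‖ ^ α

/-- `C^{m,α}_*(cl E, S)`: divergence-free Hölder fields tangential on `frontier E \ S`. -/
def HolderClassStar (m : ℕ) (α : ℝ) (E : Set V2) (n : V2 → V2) (S : Set V2)
    (f : V2 → V2) : Prop :=
  HolderClass m α (closure E) f ∧ (∀ x ∈ E, div2 f x = 0) ∧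
    ∀ x ∈ frontier E \ S, dot (f x) (n x) = 0

/-- The `L²(E;ℝ²)` inner product. -/
def l2inner (E : Set V2) (f g : V2 → V2) : ℝ := ∫ x in E, dot (f x) (g x)

/-- The first cohomology space `Z(E)`. -/
def ZE (E : Set V2) (n : V2 → V2) : Set (V2 → V2) :=
  {Q | MemLp Q 2 (volume.restrict E) ∧ (∀ x ∈ E, div2 Q x = 0) ∧
    (∀ x ∈ E, curl2 Q x = 0) ∧ ∀ x ∈ frontier E, dot (Q x) (n x) = 0}

/-- `u ∈ C⁰([0,T]; C^{k,α}(cl E; F))`. -/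
def ContHolderInTime {F : Type*} [NormedAddCommGroup F] [NormedSpace ℝ F]
    (k : ℕ) (α : ℝ) (E : Set V2) (T : ℝ) (u : V2 → ℝ → F) : Prop :=
  (∀ t ∈ Icc (0 : ℝ) T, HolderClass k α (closure E) fun x => u x t) ∧
    ∀ t₀ ∈ Icc (0 : ℝ) T,
      Tendsto (fun t => hNorm k α (closure E) fun x => u x t - u x t₀)
        (𝓝[Icc (0 : ℝ) T] t₀) (𝓝 0)

/-- `u ∈ L^∞((0,T); C^{k,α}(cl E; F))`. -/
def BddHolderInTime {F : Type*} [NormedAddCommGroup F] [NormedSpace ℝ F]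
    (k : ℕ) (α : ℝ) (E : Set V2) (T : ℝ) (u : V2 → ℝ → F) : Prop :=
  (∀ t ∈ Ioo (0 : ℝ) T, HolderClass k α (closure E) fun x => u x t) ∧
    ∃ C : ℝ, ∀ t ∈ Ioo (0 : ℝ) T, hNorm k α (closure E) (fun x => u x t) ≤ C

/-- The controlled incompressible ideal MHD system on `E × (0,T)` with forces
`fu`, `fB`, incompressibility, and tangency on the boundary portion `bdry`. -/
def MHDSystem (E bdry : Set V2) (n : V2 → V2) (T : ℝ)
    (u B : V2 → ℝ → V2) (p : V2 → ℝ → ℝ) (fu fB : V2 → ℝ → V2) : Prop :=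
  (∀ x ∈ E, ∀ t ∈ Ioo (0 : ℝ) T,
    HasDerivAt (fun s => u x s)
      (fu x t - fderiv ℝ (fun y => u y t) x (u x t)
        + fderiv ℝ (fun y => B y t) x (B x t) - grad2 (fun y => p y t) x) t) ∧
  (∀ x ∈ E, ∀ t ∈ Ioo (0 : ℝ) T,
    HasDerivAt (fun s => B x s)
      (fB x t - fderiv ℝ (fun y => B y t) x (u x t)
        + fderiv ℝ (fun y => u y t) x (B x t)) t) ∧
  (∀ x ∈ E, ∀ t ∈ Ioo (0 : ℝ) T,
    div2 (fun y => u y t) x = 0 ∧ div2 (fun y => B y t) x = 0) ∧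
  (∀ x ∈ bdry, ∀ t ∈ Ioo (0 : ℝ) T, dot (u x t) (n x) = 0 ∧ dot (B x t) (n x) = 0)

/-- The controlled incompressible Euler system. -/
def EulerSystem (E bdry : Set V2) (n : V2 → V2) (T : ℝ)
    (u : V2 → ℝ → V2) (p : V2 → ℝ → ℝ) (fu : V2 → ℝ → V2) : Prop :=
  (∀ x ∈ E, ∀ t ∈ Ioo (0 : ℝ) T,
    HasDerivAt (fun s => u x s)
      (fu x t - fderiv ℝ (fun y => u y t) x (u x t) - grad2 (fun y => p y t) x) t) ∧
  (∀ x ∈ E, ∀ t ∈ Ioo (0 : ℝ) T, div2 (fun y => u y t) x = 0) ∧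
  (∀ x ∈ bdry, ∀ t ∈ Ioo (0 : ℝ) T, dot (u x t) (n x) = 0)

/-- A Jordan curve: injective continuous image of the circle. -/
def JordanCurve (C : Set V2) : Prop :=
  ∃ f : AddCircle (1 : ℝ) → V2, Continuous f ∧ Function.Injective f ∧ range f = C

/-- A bounded doubly-connected planar domain enclosed between two disjoint nested
Jordan curves, with an outward unit normal field `n` on its boundary. -/
structure DoublyConnectedDomain where
  E : Set V2
  Γ0 : Set V2
  Γ1 : Set V2
  n : V2 → V2
  isOpen : IsOpen E
  bounded : Bornology.IsBounded E
  connected : IsConnected E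
  jordan0 : JordanCurve Γ0
  jordan1 : JordanCurve Γ1
  curves_disjoint : Disjoint Γ0 Γ1
  frontier_eq : frontier E = Γ0 ∪ Γ1
  not_simply_connected : ¬ SimplyConnectedSpace ↥E
  normal_unit : ∀ x ∈ frontier E, dot (n x) (n x) = 1

/-- A bounded simply-connected planar domain enclosed by a Jordan curve,
with an outward unit normal field `n` on its boundary. -/
structure SimplyConnectedDomain where
  Ω : Set V2
  Γ : Set V2
  n : V2 → V2
  isOpen : IsOpen Ω
  bounded : Bornology.IsBounded Ω
  connected : IsConnected Ω
  jordan : JordanCurve Γ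
  frontier_eq : frontier Ω = Γ
  simply_connected : SimplyConnectedSpace ↥Ω
  normal_unit : ∀ x ∈ frontier Ω, dot (n x) (n x) = 1

/-- `A` is relatively open in `S`. -/
def RelativelyOpenIn (A S : Set V2) : Prop :=
  A ⊆ S ∧ ∃ U : Set V2, IsOpen U ∧ A = U ∩ S

/-- Distance between two sets. -/
def setDist (A B' : Set V2) : ℝ := sInf {d | ∃ a ∈ A, ∃ b ∈ B', d = dist a b}

/-- The relative `r`-neighborhood of `S` in `cl E`. -/
def relNbhd (E : Set V2) (r : ℝ) (S : Set V2) : Set V2 :=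
  {x ∈ closure E | Metric.infDist x S < r}

/-- A smooth embedded arc. -/
def SmoothCut (Sg : Set V2) : Prop :=
  ∃ γ : ℝ → V2, ContDiff ℝ (⊤ : ℕ∞) γ ∧ InjOn γ (Icc 0 1) ∧ γ '' Icc (0 : ℝ) 1 = Sg

/-- `Y` is the flow of the time-dependent vector field `z`. -/
def IsFlowOf (z : V2 → ℝ → V2) (Y : V2 → ℝ → ℝ → V2) : Prop :=
  (∀ x s, Y x s s = x) ∧ ∀ x s t, HasDerivAt (fun r => Y x s r) (z (Y x s t) t) t


/-- Mean value inequality along a Lipschitz path. -/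
lemma norm_image_sub_le_of_lipschitz_path {G F : Type*} [NormedAddCommGroup G] [NormedSpace ℝ G]
    [NormedAddCommGroup F] [NormedSpace ℝ F] {f : G → F} (hf : Differentiable ℝ f)
    {c : ℝ → G} {a b A M : ℝ} (hab : a ≤ b) (hA : 0 ≤ A)
    (hc : ∀ x ∈ Icc a b, ∀ y ∈ Icc a b, ‖c x - c y‖ ≤ A * |x - y|)
    (hM : ∀ x ∈ Icc a b, ‖fderiv ℝ f (c x)‖ ≤ M) :
    ‖f (c b) - f (c a)‖ ≤ M * A * (b - a) := by
  have hcc : ContinuousOn c (Icc a b) := by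
    refine (LipschitzOnWith.of_dist_le_mul (K := ⟨A, hA⟩) fun x hx y hy => ?_).continuousOn
    rw [dist_eq_norm, dist_eq_norm, Real.norm_eq_abs]
    exact hc x hx y hy
  refine image_le_of_liminf_slope_right_le_deriv_boundary
    (f := fun x => ‖f (c x) - f (c a)‖) (B := fun x => M * A * (x - a)) (B' := fun _ => M * A)
    ((hf.continuous.comp_continuousOn hcc).sub continuousOn_const).norm (by simp)
    (by fun_prop) (fun x _ => ?_) (fun x hx r hr => ?_) (right_mem_Icc.2 hab)
  · simpa using (((hasDerivAt_id x).sub_const a).const_mul (M * A)).hasDerivWithinAt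
  · obtain ⟨η, hη, hηr⟩ : ∃ η > 0, (M + η) * A < r := by
      have : 0 < r - M * A := by linarith
      refine ⟨(r - M * A) / (A + 1), by positivity, ?_⟩
      have h2 : (r - M * A) / (A + 1) * A < r - M * A := by
        rw [div_mul_eq_mul_div, div_lt_iff₀ (by positivity)]
        nlinarith
      rw [add_mul]; linarith
    have hxI : x ∈ Icc a b := Ico_subset_Icc_self hx
    have h1 := ((hf (c x)).hasFDerivAt.isLittleO.def hη)
    have h2 : ∀ᶠ y in 𝓝[Icc a b] x, ‖f (c y) - f (c x) - fderiv ℝ f (c x) (c y - c x)‖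
        ≤ η * ‖c y - c x‖ := (hcc x hxI).eventually h1
    have h3 : ∀ᶠ y in 𝓝[>] x, y ∈ Ioc x b := Ioc_mem_nhdsGT hx.2
    have h4 : 𝓝[Ioc x b] x = 𝓝[>] x := nhdsWithin_Ioc_eq_nhdsGT hx.2
    have h5 : ∀ᶠ y in 𝓝[>] x, ‖f (c y) - f (c x) - fderiv ℝ f (c x) (c y - c x)‖
        ≤ η * ‖c y - c x‖ := by
      rw [← h4]
      exact h2.filter_mono
        (nhdsWithin_mono _ (Ioc_subset_Icc_self.trans (Icc_subset_Icc_left hx.1)))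
    refine Eventually.frequently ?_
    filter_upwards [h3, h5] with y hy h
    have hyI : y ∈ Icc a b := ⟨hx.1.trans hy.1.le, hy.2⟩
    have hyx : 0 < y - x := sub_pos.2 hy.1
    have e1 : ‖f (c y) - f (c x)‖ ≤ (M + η) * ‖c y - c x‖ := by
      have := norm_le_norm_add_norm_sub' (f (c y) - f (c x)) (fderiv ℝ f (c x) (c y - c x))
      have h6 := (fderiv ℝ f (c x)).le_opNorm (c y - c x)
      have h7 := mul_le_mul_of_nonneg_right (hM x hxI) (norm_nonneg (c y - c x))
      linarith
    have e2 : ‖c y - c x‖ ≤ A * (y - x) := by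
      simpa [abs_of_pos hyx] using hc y hyI x hxI
    have hM0 : 0 ≤ M := (norm_nonneg _).trans (hM x hxI)
    have e3 : ‖f (c y) - f (c a)‖ - ‖f (c x) - f (c a)‖ ≤ ‖f (c y) - f (c x)‖ := by
      simpa using norm_sub_norm_le (f (c y) - f (c a)) (f (c x) - f (c a))
    have e4 : ‖f (c y) - f (c x)‖ ≤ (M + η) * A * (y - x) :=
      e1.trans (by rw [mul_assoc]; gcongr)
    rw [slope_def_field, div_lt_iff₀ hyx]
    exact (e3.trans e4).trans_lt (by gcongr)

/-- Nagumo-type invariance: if the field `V` is tangent to the closed set `K` near `p`, then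
integral curves of `V` that start in `K` and remain near `p` stay in `K`. -/
lemma mem_of_integralCurve_of_tangent {G : Type*} [NormedAddCommGroup G] [NormedSpace ℝ G]
    [ProperSpace G] {K : Set G} (hK : IsClosed K) {V : G → G} {L : NNReal}
    (hV : LipschitzWith L V) {p : G} (hpK : p ∈ K) {ρ : ℝ}
    (htan : ∀ q ∈ K, dist q p < ρ → ∃ ζ : ℝ → G, ζ 0 = q ∧ HasDerivAt ζ (V q) 0 ∧ ∀ s, ζ s ∈ K)
    {β : ℝ → G} {a b : ℝ} (hβ : ∀ s ∈ Icc a b, HasDerivWithinAt β (V (β s)) (Icc a b) s)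
    (hp : ∀ s ∈ Icc a b, dist (β s) p < ρ / 2) (ha : β a ∈ K) :
    ∀ s ∈ Icc a b, β s ∈ K := by
  have hne : K.Nonempty := ⟨_, ha⟩
  have hcont : ContinuousOn β (Icc a b) := fun s hs => (hβ s hs).continuousWithinAt
  have hab : ∀ s ∈ Icc a b, a ∈ Icc a b := fun s hs => ⟨le_rfl, hs.1.trans hs.2⟩
  have key := le_gronwallBound_of_liminf_deriv_right_le (f := fun s => Metric.infDist (β s) K)
    (f' := fun s => L * Metric.infDist (β s) K) (δ := 0) (K := L) (ε := 0) (a := a) (b := b)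
    ((Metric.continuous_infDist_pt K).comp_continuousOn hcont) ?_
    (by simp [Metric.infDist_zero_of_mem ha]) (fun s _ => by simp)
  · intro s hs
    have h := key s hs
    rw [gronwallBound_ε0_δ0] at h
    rw [hK.mem_iff_infDist_zero hne]
    exact le_antisymm h Metric.infDist_nonneg
  · intro s hs r hr
    have hsI := Ico_subset_Icc_self hs
    obtain ⟨q, hqK, hq⟩ := hK.exists_infDist_eq_dist hne (β s)
    have hpq : dist q p < ρ := by
      have h1 := Metric.infDist_le_dist_of_mem hpK (x := β s)
      have h2 := dist_triangle_left q p (β s)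
      have h3 := hp s hsI
      linarith
    obtain ⟨ζ, hζ0, hζ, hζK⟩ := htan q hqK hpq
    have hd : HasDerivWithinAt (fun y => β y - ζ (y - s)) (V (β s) - V q) (Ici s) s := by
      refine HasDerivWithinAt.sub ?_ ?_
      · exact (hβ s hsI).mono_of_mem_nhdsWithin
          (mem_of_superset (Icc_mem_nhdsGE hs.2) (Icc_subset_Icc_left hs.1))
      · have : HasDerivAt ζ (V q) (s - s) := by simpa using hζ
        exact (this.comp_sub_const s s).hasDerivWithinAt
    have hlt : ‖V (β s) - V q‖ < r := by
      refine lt_of_le_of_lt ?_ hr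
      rw [hq, ← dist_eq_norm]; exact hV.dist_le_mul _ _
    refine (hd.liminf_right_slope_norm_le hlt).mp ?_
    filter_upwards [self_mem_nhdsWithin] with y hy h
    refine lt_of_le_of_lt ?_ h
    have hy' : (0 : ℝ) ≤ (y - s)⁻¹ := inv_nonneg.2 (sub_nonneg.2 (le_of_lt hy))
    refine mul_le_mul_of_nonneg_left ?_ hy'
    have h1 : Metric.infDist (β y) K ≤ ‖β y - ζ (y - s)‖ := by
      rw [← dist_eq_norm]; exact Metric.infDist_le_dist_of_mem (hζK _)
    simp only [sub_self, hζ0]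
    rw [hq, ← dist_eq_norm (β s) q] 
    linarith

/-- Time reversal of an integral curve. -/
lemma hasDerivWithinAt_comp_neg {G : Type*} [NormedAddCommGroup G] [NormedSpace ℝ G]
    {V : G → G} {γ : ℝ → G} {a b : ℝ}
    (h : ∀ s ∈ Icc a b, HasDerivWithinAt γ (V (γ s)) (Icc a b) s) :
    ∀ s ∈ Icc (-b) (-a), HasDerivWithinAt (fun s => γ (-s)) (-V (γ (-s))) (Icc (-b) (-a)) s := by
  intro s hs
  have hs' : -s ∈ Icc a b := ⟨by linarith [hs.2], by linarith [hs.1]⟩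
  have := (h (-s) hs').scomp s (hasDerivAt_neg s).hasDerivWithinAt
    (s := Icc (-b) (-a)) (fun u hu => ⟨by linarith [hu.2], by linarith [hu.1]⟩)
  simpa [Function.comp_def] using this

/-- Two-sided Grönwall estimate for two integral curves of a Lipschitz field. -/
lemma dist_integralCurve_le {G : Type*} [NormedAddCommGroup G] [NormedSpace ℝ G]
    {V : G → G} {L : NNReal} (hV : LipschitzWith L V) {β₁ β₂ : ℝ → G} {a b : ℝ}
    (h₁ : ∀ s ∈ Icc a b, HasDerivWithinAt β₁ (V (β₁ s)) (Icc a b) s)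
    (h₂ : ∀ s ∈ Icc a b, HasDerivWithinAt β₂ (V (β₂ s)) (Icc a b) s)
    {x y : ℝ} (hx : x ∈ Icc a b) (hy : y ∈ Icc a b) :
    dist (β₁ y) (β₂ y) ≤ dist (β₁ x) (β₂ x) * Real.exp (L * (b - a)) := by
  have fwd : ∀ {V : G → G} {γ₁ γ₂ : ℝ → G} {a b : ℝ}, LipschitzWith L V → 
      (∀ s ∈ Icc a b, HasDerivWithinAt γ₁ (V (γ₁ s)) (Icc a b) s) →
      (∀ s ∈ Icc a b, HasDerivWithinAt γ₂ (V (γ₂ s)) (Icc a b) s) →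
      ∀ {x y : ℝ}, x ∈ Icc a b → y ∈ Icc a b → x ≤ y →
      dist (γ₁ y) (γ₂ y) ≤ dist (γ₁ x) (γ₂ x) * Real.exp (L * (b - a)) := by
    intro V γ₁ γ₂ a b hV h₁ h₂ x y hx hy hxy
    have sub : Icc x y ⊆ Icc a b := Icc_subset_Icc hx.1 hy.2
    have der : ∀ {γ : ℝ → G}, (∀ s ∈ Icc a b, HasDerivWithinAt γ (V (γ s)) (Icc a b) s) →
        ∀ s ∈ Ico x y, HasDerivWithinAt γ (V (γ s)) (Ici s) s := fun h s hs =>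
      (h s (sub (Ico_subset_Icc_self hs))).mono_of_mem_nhdsWithin
        (mem_of_superset (Icc_mem_nhdsGE hs.2) ((Icc_subset_Icc_left hs.1).trans sub))
    have := dist_le_of_trajectories_ODE (v := fun _ => V) (K := L) (fun _ => hV)
      (fun s hs => ((h₁ s (sub hs)).mono sub).continuousWithinAt) (der h₁)
      (fun s hs => ((h₂ s (sub hs)).mono sub).continuousWithinAt) (der h₂) le_rfl y ⟨hxy, le_rfl⟩
    refine this.trans ?_
    have h3 : y - x ≤ b - a := by linarith [hx.1, hy.2]
    gcongr
  rcases le_total x y with hxy | hxy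
  · exact fwd hV h₁ h₂ hx hy hxy
  · have := fwd (V := fun q => -V q) hV.neg (hasDerivWithinAt_comp_neg h₁)
      (hasDerivWithinAt_comp_neg h₂) (x := -x) (y := -y)
      ⟨by linarith [hx.2], by linarith [hx.1]⟩ ⟨by linarith [hy.2], by linarith [hy.1]⟩
      (by linarith)
    simp only [neg_neg] at this
    convert this using 3
    ring

/-- Near a point where a `C¹` field has nonzero `i`-th component, the field is parallel to a
bounded, globally Lipschitz field with `i`-th component equal to one. -/
lemma exists_straightened_field {ι : Type*} [Fintype ι] [DecidableEq ι] {v : (ι → ℝ) → ι → ℝ}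
    (hv : ContDiff ℝ 1 v) {p : ι → ℝ} {i : ι} (hp : v p i ≠ 0) :
    ∃ (W : (ι → ℝ) → ι → ℝ) (L : NNReal) (B : ℝ) (ρ : ℝ), LipschitzWith L W ∧ 0 ≤ B ∧
      (∀ q, ‖W q‖ ≤ B) ∧ (∀ q, W q i = 1) ∧ 0 < ρ ∧
      ∀ q, dist q p < ρ → ∃ κ : ℝ, W q = κ • v q := by
  have hvi : ContDiff ℝ 1 fun q => v q i := contDiff_pi.1 hv i
  have hw : ContDiffAt ℝ 1 (fun q => (v q i)⁻¹ • v q) p :=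
    (hvi.contDiffAt.inv hp).smul hv.contDiffAt
  obtain ⟨L, s, hs, hL⟩ := hw.exists_lipschitzOnWith
  obtain ⟨g, hg, hgs⟩ := hL.extend_pi
  set R : ℝ := ‖(v p i)⁻¹ • v p‖ + 1 with hR
  have hR1 : 1 ≤ R := by rw [hR]; linarith [norm_nonneg ((v p i)⁻¹ • v p)]
  have hRlt : ∀ᶠ q in 𝓝 p, ‖(v q i)⁻¹ • v q‖ < R :=
    hw.continuousAt.norm.eventually (gt_mem_nhds (by rw [hR]; linarith))
  have hne : ∀ᶠ q in 𝓝 p, v q i ≠ 0 := hvi.continuous.continuousAt.eventually_ne hp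
  obtain ⟨ρ, hρ, hball⟩ := Metric.eventually_nhds_iff.1
    ((eventually_mem_set.2 hs).and (hRlt.and hne))
  refine ⟨fun q k => if k = i then 1 else max (-R) (min R (g q k)), L, R, ρ, ?_, by linarith,
    fun q => ?_, fun q => by simp, hρ, fun q hq => ⟨(v q i)⁻¹, ?_⟩⟩
  · refine LipschitzWith.of_dist_le_mul fun x y => ?_
    rw [dist_pi_le_iff (by positivity)]
    intro k
    have h1 : dist (g x k) (g y k) ≤ L * dist x y :=
      (dist_le_pi_dist _ _ k).trans (hg.dist_le_mul x y)
    by_cases hk : k = i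
    · simp only [hk, if_true, dist_self]; positivity
    · simp only [hk, if_false]
      refine le_trans ?_ h1
      have := ((LipschitzWith.id (α := ℝ)).const_min R).const_max (-R)
      simpa using this.dist_le_mul (g x k) (g y k)
  · rw [pi_norm_le_iff_of_nonneg (by linarith)]
    intro k
    by_cases hk : k = i
    · simpa [hk] using hR1
    · simp only [hk, if_false, Real.norm_eq_abs, abs_le]
      exact ⟨le_max_left _ _, max_le (by linarith) (min_le_left _ _)⟩
  · obtain ⟨h1, h2, h3⟩ := hball hq
    funext k
    by_cases hk : k = i
    · simp [hk, h3]
    · have h4 : |(v q i)⁻¹ * v q k| ≤ R := by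
        simpa using (norm_le_pi_norm ((v q i)⁻¹ • v q) k).trans h2.le
      have h5 := congrFun (hgs h1) k
      simp only [Pi.smul_apply, smul_eq_mul] at h5 ⊢
      rw [if_neg hk, ← h5, min_eq_right (abs_le.1 h4).2, max_eq_right (abs_le.1 h4).1]

/-- A bounded Lipschitz field has integral curves on every compact time interval. -/
lemma exists_integralCurve {G : Type*} [NormedAddCommGroup G] [NormedSpace ℝ G] [CompleteSpace G]
    {V : G → G} {L : NNReal} (hV : LipschitzWith L V) {B : ℝ} (hB0 : 0 ≤ B) (hB : ∀ q, ‖V q‖ ≤ B)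
    (q : G) {a b t₀ : ℝ} (ht : t₀ ∈ Icc a b) :
    ∃ β : ℝ → G, β t₀ = q ∧ ∀ s ∈ Icc a b, HasDerivWithinAt β (V (β s)) (Icc a b) s := by
  have hm : 0 ≤ max (b - t₀) (t₀ - a) := le_max_of_le_left (sub_nonneg.2 ht.2)
  have := IsPicardLindelof.of_time_independent (f := V) (tmin := a) (tmax := b) (t₀ := ⟨t₀, ht⟩)
    (x₀ := q) (a := ⟨B * max (b - t₀) (t₀ - a), by positivity⟩) (r := 0) (L := ⟨B, hB0⟩) (K := L)
    (fun x _ => hB x) hV.lipschitzOnWith (by rw [NNReal.coe_zero, sub_zero]; exact le_rfl)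
  exact this.exists_eq_forall_mem_Icc_hasDerivWithinAt₀

/-- If a closed planar set `K` is invariant under a `C¹` field that does not vanish at `p`, then
points of a connected subset of `K` near `p` are joined inside `K` by paths whose length is
comparable to their distance. -/
lemma exists_lipschitz_path_of_tangent {K : Set V2} (hK : IsClosed K) {v : V2 → V2}
    (hv : ContDiff ℝ 1 v) {p : V2} (hpK : p ∈ K) (hp : v p ≠ 0)
    (htan : ∀ q ∈ K, ∃ ζ : ℝ → V2, ζ 0 = q ∧ HasDerivAt ζ (v q) 0 ∧ ∀ s, ζ s ∈ K) :
    ∃ δ > (0 : ℝ), ∃ C ≥ (0 : ℝ), ∀ S ⊆ K ∩ Metric.ball p δ, IsPreconnected S →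
      ∀ a ∈ S, ∀ b ∈ S, ∃ c : ℝ → V2, c 0 = a ∧ c 1 = b ∧ (∀ θ ∈ Icc (0 : ℝ) 1, c θ ∈ K) ∧
        ∀ θ ∈ Icc (0 : ℝ) 1, ∀ θ' ∈ Icc (0 : ℝ) 1, ‖c θ - c θ'‖ ≤ C * ‖a - b‖ * |θ - θ'| := by
  obtain ⟨i, j, hij, hvi⟩ : ∃ i j : Fin 2, (∀ k, k = i ∨ k = j) ∧ v p i ≠ 0 := by
    by_cases h0 : v p 0 = 0
    · refine ⟨1, 0, by decide, fun h1 => hp ?_⟩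
      funext k
      fin_cases k <;> simpa
    · exact ⟨0, 1, by decide, h0⟩
  obtain ⟨W, L, B, ρ, hW, hB0, hB, hWi, hρ, hWv⟩ := exists_straightened_field hv hvi
  set δ : ℝ := ρ / (2 * (2 * B + 2)) with hδ
  have hδ0 : 0 < δ := by positivity
  have hδρ : (2 * B + 2) * δ = ρ / 2 := by rw [hδ]; field_simp
  set J : Set ℝ := Icc (p i - δ) (p i + δ) with hJ
  have hpJ : p i ∈ J := ⟨by linarith, by linarith⟩
  have hYex : ∀ q : V2, ∃ β : ℝ → V2, q i ∈ J →
      β (q i) = q ∧ ∀ s ∈ J, HasDerivWithinAt β (W (β s)) J s := by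
    intro q
    by_cases hq : q i ∈ J
    · obtain ⟨β, hβ⟩ := exists_integralCurve hW hB0 hB q hq
      exact ⟨β, fun _ => hβ⟩
    · exact ⟨0, fun h => absurd h hq⟩
  choose Y hY using hYex
  have hball : ∀ q : V2, dist q p < δ → q i ∈ J := by
    intro q hq
    have := abs_le.1 ((dist_le_pi_dist q p i).trans hq.le)
    exact ⟨by linarith [this.1], by linarith [this.2]⟩
  have hYlip : ∀ q : V2, q i ∈ J → ∀ x ∈ J, ∀ y ∈ J, dist (Y q x) (Y q y) ≤ B * |x - y| := by
    intro q hq x hx y hy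
    have := (convex_Icc (p i - δ) (p i + δ)).norm_image_sub_le_of_norm_hasDerivWithin_le
      (hY q hq).2 (fun s _ => hB _) hy hx
    rwa [dist_eq_norm]
  have hYi : ∀ q : V2, q i ∈ J → ∀ x ∈ J, Y q x i = x := by
    intro q hq x hx
    have hd : ∀ s ∈ J, HasDerivWithinAt (fun s => Y q s i - s) 0 J s := by
      intro s hs
      have h1 := (hasDerivWithinAt_pi.1 ((hY q hq).2 s hs) i).sub (hasDerivWithinAt_id s J)
      rw [hWi, sub_self] at h1
      exact h1
    have := (convex_Icc (p i - δ) (p i + δ)).norm_image_sub_le_of_norm_hasDerivWithin_le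
      hd (C := 0) (fun s _ => by simp) hq hx
    rw [zero_mul, norm_le_zero_iff, (hY q hq).1, sub_self, sub_zero] at this
    linarith
  have htan' : ∀ κ : ℝ, ∀ q ∈ K, ∃ ζ : ℝ → V2, ζ 0 = q ∧ HasDerivAt ζ (κ • v q) 0 ∧
      ∀ s, ζ s ∈ K := by
    intro κ q hq
    obtain ⟨ζ, h0, hd, hm⟩ := htan q hq
    refine ⟨fun s => ζ (κ * s), by simpa, ?_, fun s => hm _⟩
    have h1 : HasDerivAt ζ (v q) (κ * 0) := by simpa using hd
    have h2 : HasDerivAt (fun s : ℝ => κ * s) κ 0 := by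
      simpa using (hasDerivAt_id (0 : ℝ)).const_mul κ
    exact h1.scomp 0 h2
  have hnear : ∀ q : V2, dist q p < δ → ∀ x ∈ J, dist (Y q x) p < ρ / 2 := by
    intro q hq x hx
    have hqJ := hball q hq
    have h1 := hYlip q hqJ x hx (q i) hqJ
    rw [(hY q hqJ).1] at h1
    have h2 : |x - q i| ≤ 2 * δ :=
      abs_le.2 ⟨by linarith [hx.1, hqJ.2], by linarith [hx.2, hqJ.1]⟩
    have h3 := mul_le_mul_of_nonneg_left h2 hB0
    have h4 := dist_triangle (Y q x) q p
    nlinarith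
  have hYK : ∀ q ∈ K, dist q p < δ → ∀ x ∈ J, Y q x ∈ K := by
    intro q hqK hq x hx
    have hqJ := hball q hq
    rcases le_total (q i) x with hqx | hqx
    · have hsub : Icc (q i) (p i + δ) ⊆ J := Icc_subset_Icc_left hqJ.1
      refine mem_of_integralCurve_of_tangent hK hW hpK (ρ := ρ) (fun q' hq' hd => ?_)
        (fun s hs => ((hY q hqJ).2 s (hsub hs)).mono hsub) (fun s hs => hnear q hq s (hsub hs))
        (by rwa [(hY q hqJ).1]) x ⟨hqx, hx.2⟩
      obtain ⟨κ, hκ⟩ := hWv q' hd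
      rw [hκ]
      exact htan' κ q' hq'
    · have hsub : Icc (p i - δ) (q i) ⊆ J := Icc_subset_Icc_right hqJ.2
      have hneg : ∀ s ∈ Icc (-(q i)) (-(p i - δ)), -s ∈ Icc (p i - δ) (q i) :=
        fun s hs => ⟨by linarith [hs.2], by linarith [hs.1]⟩
      have := mem_of_integralCurve_of_tangent hK hW.neg hpK (ρ := ρ) (β := fun s => Y q (-s))
        (fun q' hq' hd => ?_)
        (hasDerivWithinAt_comp_neg fun s hs => ((hY q hqJ).2 s (hsub hs)).mono hsub)
        (fun s hs => hnear q hq (-s) (hsub (hneg s hs)))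
        (by rwa [neg_neg, (hY q hqJ).1]) (-x) ⟨by linarith, by linarith [hx.1]⟩
      · simpa using this
      · obtain ⟨κ, hκ⟩ := hWv q' hd
        rw [Pi.neg_apply, hκ, ← neg_smul]
        exact htan' (-κ) q' hq'
  set D : ℝ := Real.exp (L * (p i + δ - (p i - δ))) with hD
  have hD0 : 0 ≤ D := (Real.exp_pos _).le
  have hYd : ∀ q q' : V2, q i ∈ J → q' i ∈ J → ∀ x ∈ J, ∀ y ∈ J,
      dist (Y q y) (Y q' y) ≤ dist (Y q x) (Y q' x) * D := fun q q' hq hq' x hx y hy =>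
    dist_integralCurve_le hW (hY q hq).2 (hY q' hq').2 hx hy
  set m : V2 → ℝ := fun q => Y q (p i) j with hm
  have hYm : ∀ q q' : V2, q i ∈ J → q' i ∈ J → ∀ x ∈ J,
      dist (Y q x) (Y q' x) ≤ |m q - m q'| * D := by
    intro q q' hq hq' x hx
    refine (hYd q q' hq hq' (p i) hpJ x hx).trans (mul_le_mul_of_nonneg_right ?_ hD0)
    rw [dist_pi_le_iff (abs_nonneg _)]
    intro k
    rcases hij k with rfl | rfl
    · rw [hYi q hq _ hpJ, hYi q' hq' _ hpJ, dist_self]; exact abs_nonneg _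
    · exact le_rfl
  have hmlip : ∀ q q' : V2, q i ∈ J → q' i ∈ J → |m q - m q'| ≤ (1 + B) * D * dist q q' := by
    intro q q' hq hq'
    have h1 : |m q - m q'| ≤ dist (Y q (p i)) (Y q' (p i)) :=
      dist_le_pi_dist (Y q (p i)) (Y q' (p i)) j
    have h2 := hYd q q' hq hq' (q i) hq (p i) hpJ
    rw [(hY q hq).1] at h2
    have h3 := hYlip q' hq' (q' i) hq' (q i) hq
    rw [(hY q' hq').1, abs_sub_comm] at h3
    have h4 : |q i - q' i| ≤ dist q q' := dist_le_pi_dist q q' i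
    have h5 := dist_triangle q q' (Y q' (q i))
    have h6 : dist q (Y q' (q i)) ≤ (1 + B) * dist q q' := by nlinarith
    calc _ ≤ dist q (Y q' (q i)) * D := h1.trans h2
      _ ≤ (1 + B) * dist q q' * D := by gcongr
      _ = _ := by ring
  refine ⟨δ, hδ0, (1 + B) * D * D + B, by positivity, fun S hS hSc a ha b hb => ?_⟩
  have hSJ : ∀ q ∈ S, q i ∈ J := fun q hq => hball q (hS hq).2
  have hmc : ContinuousOn m S :=
    (LipschitzOnWith.of_dist_le_mul (K := ⟨(1 + B) * D, by positivity⟩)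
      fun q hq q' hq' => hmlip q q' (hSJ q hq) (hSJ q' hq')).continuousOn
  have hQex : ∀ θ : ℝ, ∃ q, θ ∈ Icc (0 : ℝ) 1 → q ∈ S ∧ m q = m a + θ * (m b - m a) := by
    intro θ
    by_cases hθ : θ ∈ Icc (0 : ℝ) 1
    · have hconv : Convex ℝ (m '' S) := (hSc.image m hmc).ordConnected.convex
      obtain ⟨q, hq, hqm⟩ := hconv.add_smul_sub_mem (mem_image_of_mem m ha)
        (mem_image_of_mem m hb) hθ
      exact ⟨q, fun _ => ⟨hq, hqm⟩⟩
    · exact ⟨a, fun h => absurd h hθ⟩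
  choose Q hQ using hQex
  have hxJ : ∀ θ ∈ Icc (0 : ℝ) 1, a i + θ * (b i - a i) ∈ J := fun θ hθ =>
    (convex_Icc (p i - δ) (p i + δ)).add_smul_sub_mem (hSJ a ha) (hSJ b hb) hθ
  have hend : ∀ q q' : V2, q ∈ S → q' ∈ S → m q = m q' → Y q (q' i) = q' := by
    intro q q' hq hq' h
    have := hYm q q' (hSJ q hq) (hSJ q' hq') (q' i) (hSJ q' hq')
    rw [h, sub_self, abs_zero, zero_mul, (hY q' (hSJ q' hq')).1] at this
    exact dist_le_zero.1 this
  have h0 : (0 : ℝ) ∈ Icc (0 : ℝ) 1 := ⟨le_rfl, zero_le_one⟩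
  have h1 : (1 : ℝ) ∈ Icc (0 : ℝ) 1 := ⟨zero_le_one, le_rfl⟩
  refine ⟨fun θ => Y (Q θ) (a i + θ * (b i - a i)), ?_, ?_, fun θ hθ => ?_, fun θ hθ θ' hθ' => ?_⟩
  · have := hend (Q 0) a (hQ 0 h0).1 ha (by simpa using (hQ 0 h0).2)
    simpa using this
  · have := hend (Q 1) b (hQ 1 h1).1 hb (by simpa using (hQ 1 h1).2)
    simpa using this
  · have hq := (hQ θ hθ).1
    exact hYK _ (hS hq).1 (hS hq).2 _ (hxJ θ hθ)
  · rw [← dist_eq_norm, ← dist_eq_norm]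
    have e1 := hYm _ _ (hSJ _ (hQ θ hθ).1) (hSJ _ (hQ θ' hθ').1) _ (hxJ θ hθ)
    have e2 := hYlip _ (hSJ _ (hQ θ' hθ').1) _ (hxJ θ hθ) _ (hxJ θ' hθ')
    have e3 : |m (Q θ) - m (Q θ')| = |θ - θ'| * |m a - m b| := by
      rw [(hQ θ hθ).2, (hQ θ' hθ').2, ← abs_mul, ← abs_neg]; congr 1; ring
    have e4 : |a i + θ * (b i - a i) - (a i + θ' * (b i - a i))| = |θ - θ'| * |a i - b i| := by
      rw [← abs_mul, ← abs_neg]; congr 1; ring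
    have e5 := hmlip a b (hSJ a ha) (hSJ b hb)
    have e6 : |a i - b i| ≤ dist a b := dist_le_pi_dist a b i
    rw [e3] at e1
    rw [e4] at e2
    calc _ ≤ _ := dist_triangle _ _ _
      _ ≤ |θ - θ'| * |m a - m b| * D + B * (|θ - θ'| * |a i - b i|) := add_le_add e1 e2
      _ ≤ |θ - θ'| * ((1 + B) * D * dist a b) * D + B * (|θ - θ'| * dist a b) := by gcongr
      _ = _ := by ring

/-- Trajectories of a time-dependent field that stay in an invariant closed planar set, on which
the spatial derivative of the field is bounded, are determined by their initial value. No
geometric regularity of the set is needed. -/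
lemma trajectory_unique {K : Set V2} (hK : IsClosed K) {T M : ℝ} {z : V2 → ℝ → V2}
    (hz : ∀ t ∈ Icc (0 : ℝ) T, ContDiff ℝ 1 fun y => z y t)
    (hM : ∀ t ∈ Icc (0 : ℝ) T, ∀ x ∈ K, ‖fderiv ℝ (fun y => z y t) x‖ ≤ M)
    (hzc : ContinuousOn (fun q : V2 × ℝ => z q.1 q.2) (K ×ˢ Icc (0 : ℝ) T))
    {Z : V2 → ℝ → ℝ → V2} (hflow : IsFlowOf z Z) (hinv : ∀ x ∈ K, ∀ s t : ℝ, Z x s t ∈ K)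
    {γ₁ γ₂ : ℝ → V2} (h₁ : ∀ r, HasDerivAt γ₁ (z (γ₁ r) r) r)
    (h₂ : ∀ r, HasDerivAt γ₂ (z (γ₂ r) r) r) (hK₁ : ∀ r, γ₁ r ∈ K) (hK₂ : ∀ r, γ₂ r ∈ K)
    {s t : ℝ} (hs : 0 ≤ s) (ht : t ≤ T) (heq : γ₁ s = γ₂ s) :
    ∀ r ∈ Icc s t, γ₁ r = γ₂ r := by
  have hc₁ : Continuous γ₁ := continuous_iff_continuousAt.2 fun r => (h₁ r).continuousAt
  have hc₂ : Continuous γ₂ := continuous_iff_continuousAt.2 fun r => (h₂ r).continuousAt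
  change Icc s t ⊆ {r | γ₁ r = γ₂ r}
  refine IsClosed.Icc_subset_of_forall_mem_nhdsWithin
    ((isClosed_eq hc₁ hc₂).inter isClosed_Icc) heq ?_
  rintro r₀ ⟨hr₀, hr₀I⟩
  have hr₀' : γ₁ r₀ = γ₂ r₀ := hr₀
  have hr₀0 : 0 ≤ r₀ := hs.trans hr₀I.1
  have hr₀T : r₀ ∈ Icc (0 : ℝ) T := ⟨hr₀0, hr₀I.2.le.trans ht⟩
  have hM0 : 0 ≤ M := (norm_nonneg _).trans (hM r₀ hr₀T _ (hK₁ r₀))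
  by_cases hp : ∀ τ ∈ Icc (0 : ℝ) T, z (γ₁ r₀) τ = 0
  · have rest : ∀ γ : ℝ → V2, (∀ r, HasDerivAt γ (z (γ r) r) r) → (∀ r, γ r ∈ K) →
        γ r₀ = γ₁ r₀ → ∀ᶠ r in 𝓝[>] r₀, γ r = γ₁ r₀ := by
      intro γ hγ hγK hγ0
      have hγc : Continuous γ := continuous_iff_continuousAt.2 fun r => (hγ r).continuousAt
      set b : ℝ := min t (r₀ + 1 / (2 * (M + 1))) with hb
      have hr₀b : r₀ < b := lt_min hr₀I.2 (by linarith [show 0 < 1 / (2 * (M + 1)) by positivity])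
      have hbI : ∀ r ∈ Icc r₀ b, r ∈ Icc (0 : ℝ) T := fun r hr =>
        ⟨hr₀0.trans hr.1, hr.2.trans ((min_le_left _ _).trans ht)⟩
      have hspeed : ContinuousOn (fun r => ‖z (γ r) r‖) (Icc r₀ b) :=
        (hzc.comp (f := fun r => (γ r, r)) (by fun_prop) fun r hr => ⟨hγK r, hbI r hr⟩).norm
      obtain ⟨r', hr', hmax⟩ := isCompact_Icc.exists_isMaxOn (nonempty_Icc.2 hr₀b.le) hspeed
      set N : ℝ := ‖z (γ r') r'‖ with hN
      have hN0 : 0 ≤ N := norm_nonneg _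
      have hlip : ∀ x ∈ Icc r₀ b, ∀ y ∈ Icc r₀ b, ‖γ x - γ y‖ ≤ N * |x - y| :=
        fun x hx y hy => (convex_Icc r₀ b).norm_image_sub_le_of_norm_hasDerivWithin_le
          (fun r _ => (hγ r).hasDerivWithinAt) (fun r hr => hmax hr) hy hx
      have hsub : Icc r₀ r' ⊆ Icc r₀ b := Icc_subset_Icc_right hr'.2
      have h := norm_image_sub_le_of_lipschitz_path
        ((hz r' (hbI r' hr')).differentiable one_ne_zero)
        hr'.1 hN0 (fun x hx y hy => hlip x (hsub hx) y (hsub hy))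
        (fun x _ => hM r' (hbI r' hr') _ (hγK x))
      rw [hγ0, hp r' (hbI r' hr'), sub_zero] at h
      have h3 : M * (r' - r₀) ≤ 1 / 2 := by
        have : r' - r₀ ≤ 1 / (2 * (M + 1)) := by linarith [hr'.2.trans (min_le_right _ _)]
        calc M * (r' - r₀) ≤ M * (1 / (2 * (M + 1))) := by gcongr
          _ ≤ 1 / 2 := by
            rw [mul_one_div, div_le_div_iff₀ (by positivity) (by positivity)]
            linarith
      have hN00 : N = 0 := by nlinarith
      filter_upwards [Icc_mem_nhdsGT hr₀b] with r hr
      have := hlip r hr r₀ ⟨le_rfl, hr₀b.le⟩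
      rw [hN00, zero_mul, norm_le_zero_iff, sub_eq_zero] at this
      rw [this, hγ0]
    filter_upwards [rest γ₁ h₁ hK₁ rfl, rest γ₂ h₂ hK₂ hr₀'.symm] with r e₁ e₂
    exact e₁.trans e₂.symm
  · push Not at hp
    obtain ⟨τ, hτ, hpτ⟩ := hp
    obtain ⟨δ, hδ, C, hC, hpath⟩ := exists_lipschitz_path_of_tangent hK (hz τ hτ) (hK₁ r₀) hpτ
      (fun q hq => ⟨fun s => Z q τ (τ + s), by simp [hflow.1], by
        have := hflow.2 q τ (τ + 0)
        simpa [hflow.1] using this.comp_const_add τ 0, fun s => hinv q hq _ _⟩)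
    have hev : ∀ᶠ r in 𝓝 r₀, γ₁ r ∈ Metric.ball (γ₁ r₀) δ ∧ γ₂ r ∈ Metric.ball (γ₁ r₀) δ :=
      (hc₁.continuousAt.eventually (Metric.ball_mem_nhds _ hδ)).and
        (hc₂.continuousAt.eventually (by rw [← hr₀']; exact Metric.ball_mem_nhds _ hδ))
    obtain ⟨ε, hε, hball⟩ := Metric.eventually_nhds_iff.1 hev
    set b : ℝ := min t (r₀ + ε / 2) with hb
    have hr₀b : r₀ < b := lt_min hr₀I.2 (by linarith)
    have hbI : ∀ r ∈ Icc r₀ b, r ∈ Icc (0 : ℝ) T := fun r hr =>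
      ⟨hr₀0.trans hr.1, hr.2.trans ((min_le_left _ _).trans ht)⟩
    have hbε : ∀ r ∈ Icc r₀ b, dist r r₀ < ε := fun r hr => by
      have := hr.2.trans (min_le_right _ _)
      rw [Real.dist_eq, abs_of_nonneg (sub_nonneg.2 hr.1)]
      linarith
    have hr₀m : r₀ ∈ Icc r₀ b := ⟨le_rfl, hr₀b.le⟩
    have hSc : IsPreconnected (γ₁ '' Icc r₀ b ∪ γ₂ '' Icc r₀ b) :=
      IsPreconnected.union (γ₁ r₀) (mem_image_of_mem _ hr₀m)
        (by rw [hr₀']; exact mem_image_of_mem _ hr₀m)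
        (isPreconnected_Icc.image _ hc₁.continuousOn) (isPreconnected_Icc.image _ hc₂.continuousOn)
    have hSK : γ₁ '' Icc r₀ b ∪ γ₂ '' Icc r₀ b ⊆ K ∩ Metric.ball (γ₁ r₀) δ := by
      rintro _ (⟨r, hr, rfl⟩ | ⟨r, hr, rfl⟩)
      · exact ⟨hK₁ r, (hball (hbε r hr)).1⟩
      · exact ⟨hK₂ r, (hball (hbε r hr)).2⟩
    have hzero := eq_zero_of_abs_deriv_le_mul_abs_self_of_eq_zero_right
      (f := fun r => γ₁ r - γ₂ r) (f' := fun r => z (γ₁ r) r - z (γ₂ r) r) (K := M * C)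
      (a := r₀) (b := b) (hc₁.sub hc₂).continuousOn
      (fun r _ => ((h₁ r).sub (h₂ r)).hasDerivWithinAt) (sub_eq_zero.2 hr₀') (fun r hr => ?_)
    · filter_upwards [Icc_mem_nhdsGT hr₀b] with r hr
      exact sub_eq_zero.1 (hzero r hr)
    · have hrI := Ico_subset_Icc_self hr
      obtain ⟨c, hc0, hc1, hcK, hcl⟩ := hpath _ hSK hSc (γ₂ r) (Or.inr (mem_image_of_mem _ hrI))
        (γ₁ r) (Or.inl (mem_image_of_mem _ hrI))
      have := norm_image_sub_le_of_lipschitz_path ((hz r (hbI r hrI)).differentiable one_ne_zero)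
        zero_le_one (by positivity) hcl (fun x hx => hM r (hbI r hrI) _ (hcK x hx))
      rw [hc0, hc1, norm_sub_rev (γ₂ r)] at this
      linarith

lemma le_biSup_of_forall_le {ι : Type*} {s : Set ι} {f : ι → ℝ} {C : ℝ}
    (hC : ∀ x ∈ s, f x ≤ C) {x : ι} (hx : x ∈ s) : f x ≤ ⨆ y ∈ s, f y := by
  have hb : BddAbove (range fun y => ⨆ _ : y ∈ s, f y) := by
    refine ⟨max C 0, ?_⟩
    rintro _ ⟨y, rfl⟩
    exact Real.iSup_le (fun hy => (hC y hy).trans (le_max_left _ _)) (le_max_right _ _)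
  simpa [ciSup_pos hx] using le_ciSup hb x

lemma hNorm_seminorm_nonneg {F : Type*} [NormedAddCommGroup F] [NormedSpace ℝ F]
    (m : ℕ) (α : ℝ) (K : Set V2) (f : V2 → F) :
    0 ≤ ⨆ x ∈ K, ⨆ y ∈ K,
      ‖iteratedFDeriv ℝ m f x - iteratedFDeriv ℝ m f y‖ / ‖x - y‖ ^ α :=
  Real.iSup_nonneg fun _ => Real.iSup_nonneg fun _ => Real.iSup_nonneg fun _ =>
    Real.iSup_nonneg fun _ => by positivity

lemma norm_iteratedFDeriv_le_hNorm {F : Type*} [NormedAddCommGroup F] [NormedSpace ℝ F]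
    {m : ℕ} (α : ℝ) {K : Set V2} (hK : IsCompact K) {f : V2 → F} (hf : ContDiff ℝ m f)
    {k : ℕ} (hk : k ≤ m) {x : V2} (hx : x ∈ K) :
    ‖iteratedFDeriv ℝ k f x‖ ≤ hNorm m α K f := by
  obtain ⟨C, hC⟩ := hK.exists_bound_of_continuousOn
    (hf.continuous_iteratedFDeriv (by exact_mod_cast hk)).continuousOn
  have h1 : ‖iteratedFDeriv ℝ k f x‖ ≤ ⨆ x ∈ K, ‖iteratedFDeriv ℝ k f x‖ :=
    le_biSup_of_forall_le (f := fun x => ‖iteratedFDeriv ℝ k f x‖) hC hx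
  have h2 := Finset.single_le_sum
    (f := fun k => ⨆ x ∈ K, ‖iteratedFDeriv ℝ k f x‖) (s := Finset.range (m + 1))
    (fun k _ => Real.iSup_nonneg fun _ => Real.iSup_nonneg fun _ => norm_nonneg _)
    (Finset.mem_range.2 (Nat.lt_succ_of_le hk))
  have h3 := hNorm_seminorm_nonneg m α K f
  unfold hNorm
  linarith

lemma norm_sub_le_hNorm_mul_rpow {F : Type*} [NormedAddCommGroup F] [NormedSpace ℝ F]
    {α : ℝ} {K : Set V2} {f : V2 → F} (hf : HolderClass 0 α K f)
    {x y : V2} (hx : x ∈ K) (hy : y ∈ K) (hxy : x ≠ y) :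
    ‖f x - f y‖ ≤ hNorm 0 α K f * ‖x - y‖ ^ α := by
  obtain ⟨-, C, -, hC⟩ := hf
  have hpos : ∀ {x y : V2}, x ≠ y → 0 < ‖x - y‖ ^ α := fun h =>
    Real.rpow_pos_of_pos (norm_sub_pos_iff.2 h) _
  set q : V2 → V2 → ℝ := fun x y =>
    ‖iteratedFDeriv ℝ 0 f x - iteratedFDeriv ℝ 0 f y‖ / ‖x - y‖ ^ α with hq
  have hq0 : ∀ x y, 0 ≤ q x y := fun x y => by positivity
  have hqC : ∀ x ∈ K, ∀ y ∈ K, q x y ≤ max C 0 := by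
    intro x hx y hy
    rcases eq_or_ne x y with rfl | h
    · simp [q]
    · exact ((div_le_iff₀ (hpos h)).2 (hC x hx y hy)).trans (le_max_left _ _)
  have h1 : q x y ≤ ⨆ y ∈ K, q x y := le_biSup_of_forall_le (hqC x hx) hy
  have h2 : (⨆ y ∈ K, q x y) ≤ ⨆ x ∈ K, ⨆ y ∈ K, q x y :=
    le_biSup_of_forall_le (f := fun x => ⨆ y ∈ K, q x y) (C := max C 0)
      (fun x hx => Real.iSup_le (fun y => Real.iSup_le (hqC x hx y) (le_max_right _ _))
        (le_max_right _ _)) hx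
  have h3 : q x y ≤ hNorm 0 α K f := by
    refine (h1.trans h2).trans ?_
    unfold hNorm
    exact le_add_of_nonneg_left (Finset.sum_nonneg fun k _ =>
      Real.iSup_nonneg fun _ => Real.iSup_nonneg fun _ => norm_nonneg _)
  have h4 : ‖iteratedFDeriv ℝ 0 f x - iteratedFDeriv ℝ 0 f y‖ = ‖f x - f y‖ := by
    simp only [iteratedFDeriv_zero_eq_comp, Function.comp_apply]
    rw [← map_sub, LinearIsometryEquiv.norm_map]
  rw [← h4]
  exact (div_le_iff₀ (hpos hxy)).1 h3

lemma continuousOn_prod_of_forall_eventually {X F : Type*} [TopologicalSpace X]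
    [NormedAddCommGroup F] {K : Set X} {I : Set ℝ} {f : X → ℝ → F}
    (h₁ : ∀ t ∈ I, ContinuousOn (fun x => f x t) K)
    (h₂ : ∀ t₀ ∈ I, ∀ ε > 0, ∀ᶠ t in 𝓝[I] t₀, ∀ x ∈ K, ‖f x t - f x t₀‖ < ε) :
    ContinuousOn (fun q : X × ℝ => f q.1 q.2) (K ×ˢ I) := by
  rintro ⟨x₀, t₀⟩ ⟨hx₀, ht₀⟩
  rw [ContinuousWithinAt, nhdsWithin_prod_eq, Metric.tendsto_nhds]
  intro ε hε
  have e₁ : ∀ᶠ x in 𝓝[K] x₀, dist (f x t₀) (f x₀ t₀) < ε / 2 :=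
    Metric.tendsto_nhds.1 (h₁ t₀ ht₀ x₀ hx₀) _ (half_pos hε)
  filter_upwards [(e₁.and eventually_mem_nhdsWithin).prod_mk (h₂ t₀ ht₀ _ (half_pos hε))]
    with q hq
  have h := hq.2 q.1 hq.1.2
  rw [← dist_eq_norm] at h
  have := dist_triangle (f q.1 q.2) (f q.1 t₀) (f x₀ t₀)
  linarith [hq.1.1]

lemma ContHolderInTime.eventually_hNorm_lt {F : Type*} [NormedAddCommGroup F] [NormedSpace ℝ F]
    {k : ℕ} {α T : ℝ} {E : Set V2} {u : V2 → ℝ → F} (hu : ContHolderInTime k α E T u)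
    {t₀ : ℝ} (ht₀ : t₀ ∈ Icc (0 : ℝ) T) {ε : ℝ} (hε : 0 < ε) :
    ∀ᶠ t in 𝓝[Icc (0 : ℝ) T] t₀, t ∈ Icc (0 : ℝ) T ∧
      hNorm k α (closure E) (fun x => u x t - u x t₀) < ε :=
  eventually_mem_nhdsWithin.and ((hu.2 t₀ ht₀).eventually (gt_mem_nhds hε))

lemma ContHolderInTime.continuousOn {F : Type*} [NormedAddCommGroup F] [NormedSpace ℝ F]
    {k : ℕ} {α T : ℝ} {E : Set V2} (hE : IsCompact (closure E)) {u : V2 → ℝ → F}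
    (hu : ContHolderInTime k α E T u) :
    ContinuousOn (fun q : V2 × ℝ => u q.1 q.2) (closure E ×ˢ Icc (0 : ℝ) T) := by
  refine continuousOn_prod_of_forall_eventually
    (fun t ht => (hu.1 t ht).1.continuous.continuousOn) fun t₀ ht₀ ε hε => ?_
  filter_upwards [hu.eventually_hNorm_lt ht₀ hε] with t ht x hx
  have := norm_iteratedFDeriv_le_hNorm α hE ((hu.1 t ht.1).1.sub (hu.1 t₀ ht₀).1) (Nat.zero_le k) hx
  rw [norm_iteratedFDeriv_zero] at this
  exact this.trans_lt ht.2

lemma ContHolderInTime.continuousOn_fderiv {F : Type*} [NormedAddCommGroup F] [NormedSpace ℝ F]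
    {α T : ℝ} {E : Set V2} (hE : IsCompact (closure E)) {u : V2 → ℝ → F}
    (hu : ContHolderInTime 1 α E T u) :
    ContinuousOn (fun q : V2 × ℝ => fderiv ℝ (fun y => u y q.2) q.1)
      (closure E ×ˢ Icc (0 : ℝ) T) := by
  have hd : ∀ t ∈ Icc (0 : ℝ) T, ContDiff ℝ 1 fun x => u x t := fun t ht => (hu.1 t ht).1
  refine continuousOn_prod_of_forall_eventually (f := fun x t => fderiv ℝ (fun y => u y t) x)
    (fun t ht => ((hd t ht).continuous_fderiv one_ne_zero).continuousOn) fun t₀ ht₀ ε hε => ?_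
  filter_upwards [hu.eventually_hNorm_lt ht₀ hε] with t ht x hx
  have := norm_iteratedFDeriv_le_hNorm α hE ((hu.1 t ht.1).1.sub (hu.1 t₀ ht₀).1) le_rfl hx
  rw [norm_iteratedFDeriv_one, fderiv_fun_sub ((hd t ht.1).differentiable one_ne_zero x)
    ((hd t₀ ht₀).differentiable one_ne_zero x)] at this
  exact this.trans_lt ht.2

/-- Mean value estimate: if the right derivative of `f` stays within `ε` of `A`, then `f` is
within `ε` of the affine function of slope `A`. -/
lemma norm_sub_sub_smul_le {F : Type*} [NormedAddCommGroup F] [NormedSpace ℝ F] {f f' : ℝ → F}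
    {A : F} {ε a b : ℝ} (hab : a ≤ b) (hf : ∀ s ∈ Icc a b, HasDerivAt f (f' s) s)
    (hA : ∀ s ∈ Icc a b, ‖f' s - A‖ ≤ ε) : ‖f b - f a - (b - a) • A‖ ≤ ε * (b - a) := by
  have h := (convex_Icc a b).norm_image_sub_le_of_norm_hasDerivWithin_le
    (f := fun s => f s - s • A) (f' := fun s => f' s - A)
    (fun s hs => by
      simpa using ((hf s hs).fun_sub ((hasDerivAt_id' s).smul_const A)).hasDerivWithinAt)
    hA ⟨le_rfl, hab⟩ ⟨hab, le_rfl⟩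
  rw [Real.norm_of_nonneg (sub_nonneg.2 hab)] at h
  convert h using 2
  module

lemma exists_forall_Ico_of_eventually_prod {X : Type*} {l : Filter X} {σ : ℝ} {p : X → ℝ → Prop}
    (h : ∀ᶠ q in l ×ˢ 𝓝 σ, p q.1 q.2) :
    ∀ᶠ r in 𝓝[≥] σ, σ ≤ r ∧ ∀ᶠ x in l, ∀ s ∈ Icc σ r, p x s := by
  obtain ⟨P, hP, Q, hQ, hPQ⟩ := eventually_prod_iff.1 h
  obtain ⟨δ, hδ, hball⟩ := Metric.eventually_nhds_iff.1 hQ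
  filter_upwards [Ico_mem_nhdsGE (lt_add_of_pos_right σ hδ)] with r hr
  refine ⟨hr.1, ?_⟩
  filter_upwards [hP] with x hx s hs
  refine hPQ hx (hball ?_)
  rw [Real.dist_eq, abs_of_nonneg (sub_nonneg.2 hs.1)]
  linarith [hs.2, hr.2]

/-- Along a trajectory on which the source vanishes, the transported field satisfies the linear
stretching equation, up to the boundary of the domain. -/
lemma hasDerivWithinAt_along_trajectory {E : Set V2} (hEc : IsCompact (closure E))
    {T α C : ℝ} (hα : 0 < α) {z g H : V2 → ℝ → V2}
    (hz : ContHolderInTime 1 α E T z) (hH : ContHolderInTime 1 α E T H)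
    (hg : ∀ s ∈ Ioo (0 : ℝ) T, ∀ x ∈ closure E, ∀ y ∈ closure E,
      ‖g x s - g y s‖ ≤ C * ‖x - y‖ ^ α)
    (heq : ∀ x ∈ E, ∀ t ∈ Ioo (0 : ℝ) T,
      HasDerivAt (fun s => H x s)
        (g x t - fderiv ℝ (fun y => H y t) x (z x t)
          + fderiv ℝ (fun y => z y t) x (H x t)) t)
    {γ : ℝ → V2} (hγ : ∀ r, HasDerivAt γ (z (γ r) r) r) (hγK : ∀ r, γ r ∈ closure E)
    {t : ℝ} (ht : t ≤ T) (hg0 : ∀ s ∈ Icc 0 t, g (γ s) s = 0) {σ : ℝ} (hσ : σ ∈ Ioo 0 t) :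
    HasDerivWithinAt (fun s => H (γ s) s)
      (fderiv ℝ (fun y => z y σ) (γ σ) (H (γ σ) σ)) (Ici σ) σ := by
  have hγc : Continuous γ := continuous_iff_continuousAt.2 fun r => (hγ r).continuousAt
  have hσT : Ioo 0 t ∈ 𝓝 σ := Ioo_mem_nhds hσ.1 hσ.2
  have hIT : ∀ s ∈ Ioo 0 t, s ∈ Icc 0 T := fun s hs => ⟨hs.1.le, hs.2.le.trans ht⟩
  have hIn : Icc 0 T ∈ 𝓝 σ := mem_of_superset hσT hIT
  have hzc := hz.continuousOn hEc
  have hHc := hH.continuousOn hEc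
  have hDzc := hz.continuousOn_fderiv hEc
  have hDHc := hH.continuousOn_fderiv hEc
  set A : V2 := -fderiv ℝ (fun y => H y σ) (γ σ) (z (γ σ) σ)
    + fderiv ℝ (fun y => z y σ) (γ σ) (H (γ σ) σ) with hA
  set B : V2 := fderiv ℝ (fun y => H y σ) (γ σ) (z (γ σ) σ) with hB
  have hfrozen : ∀ ε > 0, ∀ᶠ r in 𝓝[≥] σ,
      ‖H (γ σ) r - H (γ σ) σ - (r - σ) • A‖ ≤ ε * (r - σ) := by
    intro ε hε
    have hc : ContinuousOn (fun q : V2 × ℝ => -fderiv ℝ (fun y => H y q.2) q.1 (z q.1 q.2)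
        + fderiv ℝ (fun y => z y q.2) q.1 (H q.1 q.2)) (closure E ×ˢ Icc (0 : ℝ) T) :=
      (hDHc.clm_apply hzc).neg.add (hDzc.clm_apply hHc)
    have h1 : ∀ᶠ q in 𝓝[E] (γ σ) ×ˢ 𝓝 σ,
        ‖-fderiv ℝ (fun y => H y q.2) q.1 (z q.1 q.2)
          + fderiv ℝ (fun y => z y q.2) q.1 (H q.1 q.2) - A‖ < ε / 2 := by
      have := hc (γ σ, σ) ⟨hγK σ, hIT σ hσ⟩
      rw [ContinuousWithinAt, nhdsWithin_prod_eq, nhdsWithin_eq_nhds.2 hIn] at this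
      simpa only [dist_eq_norm] using Metric.tendsto_nhds.1
        (this.mono_left (prod_mono_left _ (nhdsWithin_mono _ subset_closure))) _ (half_pos hε)
    have h2 : ∀ᶠ q in 𝓝[E] (γ σ) ×ˢ 𝓝 σ, C * ‖q.1 - γ q.2‖ ^ α < ε / 2 := by
      have hcont : Continuous fun q : V2 × ℝ => C * ‖q.1 - γ q.2‖ ^ α :=
        continuous_const.mul ((continuous_fst.sub (hγc.comp continuous_snd)).norm.rpow_const
          fun _ => Or.inr hα.le)
      have h := hcont.tendsto (γ σ, σ)
      rw [nhds_prod_eq] at h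
      refine (h.mono_left (prod_mono_left _ nhdsWithin_le_nhds)).eventually (gt_mem_nhds ?_)
      simpa [Real.zero_rpow hα.ne'] using hε
    have h3 : ∀ᶠ q in 𝓝[E] (γ σ) ×ˢ 𝓝 σ, q.1 ∈ E ∧ q.2 ∈ Ioo 0 t :=
      eventually_mem_nhdsWithin.prod_mk hσT
    filter_upwards [exists_forall_Ico_of_eventually_prod
      (p := fun x s => ‖-fderiv ℝ (fun y => H y s) x (z x s)
          + fderiv ℝ (fun y => z y s) x (H x s) - A‖ < ε / 2 ∧ C * ‖x - γ s‖ ^ α < ε / 2 ∧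
          x ∈ E ∧ s ∈ Ioo 0 t) (h1.and (h2.and h3))] with r hr
    have : (𝓝[E] (γ σ)).NeBot := mem_closure_iff_nhdsWithin_neBot.1 (hγK σ)
    obtain ⟨x₁, hx₁⟩ := hr.2.exists
    have hrI := hIT r (hx₁ r ⟨hr.1, le_rfl⟩).2.2.2
    have hHr : ∀ s ∈ Icc (0 : ℝ) T, Tendsto (fun x => H x s) (𝓝[E] (γ σ)) (𝓝 (H (γ σ) s)) :=
      fun s hs => ((hH.1 s hs).1.continuous.tendsto _).mono_left nhdsWithin_le_nhds
    refine le_of_tendsto (((hHr r hrI).sub (hHr σ (hIT σ hσ))).sub_const _).norm ?_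
    filter_upwards [hr.2] with x hx
    refine norm_sub_sub_smul_le hr.1 (f := fun s => H x s)
      (fun s hs => heq x (hx s hs).2.2.1 s
        ⟨(hx s hs).2.2.2.1, (hx s hs).2.2.2.2.trans_le ht⟩) fun s hs => ?_
    obtain ⟨e1, e2, hxE, hsI⟩ := hx s hs
    have e3 := hg s ⟨hsI.1, hsI.2.trans_le ht⟩ x (subset_closure hxE) (γ s) (hγK s)
    rw [hg0 s (Ioo_subset_Icc_self hsI), sub_zero] at e3
    calc _ = ‖g x s + (-fderiv ℝ (fun y => H y s) x (z x s)
          + fderiv ℝ (fun y => z y s) x (H x s) - A)‖ := by congr 1; abel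
      _ ≤ _ := norm_add_le _ _
      _ ≤ ε := by linarith
  have hmoving : ∀ ε > 0, ∀ᶠ r in 𝓝[≥] σ,
      ‖H (γ r) r - H (γ σ) r - (r - σ) • B‖ ≤ ε * (r - σ) := by
    intro ε hε
    have hc : ContinuousOn (fun q : ℝ × ℝ => fderiv ℝ (fun y => H y q.1) (γ q.2)
        (z (γ q.2) q.2)) (Icc (0 : ℝ) T ×ˢ Icc (0 : ℝ) T) :=
      (hDHc.comp (f := fun q : ℝ × ℝ => (γ q.2, q.1)) (by fun_prop)
        fun q hq => ⟨hγK _, hq.1⟩).clm_apply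
      (hzc.comp (f := fun q : ℝ × ℝ => (γ q.2, q.2)) (by fun_prop) fun q hq => ⟨hγK _, hq.2⟩)
    have h1 : ∀ᶠ q in 𝓝 σ ×ˢ 𝓝 σ, ‖fderiv ℝ (fun y => H y q.1) (γ q.2)
        (z (γ q.2) q.2) - B‖ < ε ∧ q.1 ∈ Icc 0 T := by
      have := hc.continuousAt (prod_mem_nhds hIn hIn)
      rw [ContinuousAt, nhds_prod_eq] at this
      refine (?_ : ∀ᶠ q in 𝓝 σ ×ˢ 𝓝 σ, _).and
        ((show ∀ᶠ r in 𝓝 σ, r ∈ Icc 0 T from hIn).prod_inl _)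
      simpa only [dist_eq_norm] using Metric.tendsto_nhds.1 this _ hε
    obtain ⟨P, hP, Q, hQ, hPQ⟩ := eventually_prod_iff.1 h1
    have h2 := exists_forall_Ico_of_eventually_prod (l := pure ()) (p := fun _ s => Q s)
      (hQ.prod_inr _)
    filter_upwards [h2, nhdsWithin_le_nhds hP] with r hr hPr
    have hQr : ∀ s ∈ Icc σ r, Q s := by simpa using hr.2
    have hrI := (hPQ hPr (hQr r ⟨hr.1, le_rfl⟩)).2
    exact norm_sub_sub_smul_le hr.1 (f := fun s => H (γ s) r)
      (fun s _ => ((((hH.1 r hrI).1.differentiable one_ne_zero) (γ s)).hasFDerivAt.comp_hasDerivAt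
        s (hγ s))) fun s hs => (hPQ hPr (hQr s hs)).1.le
  rw [hasDerivWithinAt_iff_isLittleO, Asymptotics.isLittleO_iff]
  intro ε hε
  filter_upwards [hfrozen _ (half_pos hε), hmoving _ (half_pos hε), self_mem_nhdsWithin]
    with r h1 h2 hr
  rw [Real.norm_of_nonneg (sub_nonneg.2 hr)]
  have hAB : fderiv ℝ (fun y => z y σ) (γ σ) (H (γ σ) σ) = A + B := by rw [hA]; abel
  rw [hAB]
  calc _ = ‖(H (γ σ) r - H (γ σ) σ - (r - σ) • A) + (H (γ r) r - H (γ σ) r - (r - σ) • B)‖ := by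
        congr 1; module
    _ ≤ _ := norm_add_le _ _
    _ ≤ _ := by linarith

/-- A continuous curve whose right derivative on the open interval is bounded by a multiple of its
norm vanishes if it starts at zero. -/
lemma eq_zero_of_norm_deriv_right_le {F : Type*} [NormedAddCommGroup F] [NormedSpace ℝ F]
    {f f' : ℝ → F} {M a b : ℝ} (hab : a < b) (hf : ContinuousOn f (Icc a b)) (ha : f a = 0)
    (hf' : ∀ s ∈ Ioo a b, HasDerivWithinAt f (f' s) (Ici s) s)
    (hM : ∀ s ∈ Ioo a b, ‖f' s‖ ≤ M * ‖f s‖) : f b = 0 := by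
  have hle : ∀ s ∈ Ioo a b, ‖f b‖ ≤ ‖f s‖ * Real.exp (M * (b - s)) := by
    intro s hs
    have := norm_le_gronwallBound_of_norm_deriv_right_le (ε := 0)
      (hf.mono (Icc_subset_Icc_left hs.1.le))
      (fun r hr => hf' r ⟨hs.1.trans_le hr.1, hr.2⟩) le_rfl
      (fun r hr => by simpa using hM r ⟨hs.1.trans_le hr.1, hr.2⟩) b ⟨hs.2.le, le_rfl⟩
    rwa [gronwallBound_ε0] at this
  have hlim : Tendsto (fun s => ‖f s‖ * Real.exp (M * (b - s))) (𝓝[>] a) (𝓝 0) := by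
    have h1 : Tendsto f (𝓝[>] a) (𝓝 (f a)) :=
      ((hf a ⟨le_rfl, hab.le⟩).mono_of_mem_nhdsWithin (Icc_mem_nhdsGT hab)).tendsto
    have h2 : Continuous fun s => Real.exp (M * (b - s)) := by fun_prop
    simpa [ha] using h1.norm.mul ((h2.tendsto a).mono_left nhdsWithin_le_nhds)
  exact norm_le_zero_iff.1 (ge_of_tendsto hlim
    (by filter_upwards [Ioo_mem_nhdsGT hab] with s hs using hle s hs))
/-- Lemma 4 of the paper: the support of the solution of the linear
induction (transport-stretching) problem is carried by the flow of the drift, together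
with the flown-out supports of the source term. -/
theorem magnetic_support_transport
    (E : Set V2) (hE : IsOpen E) (hEb : Bornology.IsBounded E) (n : V2 → V2)
    (Tt : ℝ) (hT : 0 < Tt) (α : ℝ) (hα : α ∈ Ioo (0 : ℝ) 1)
    (z g H : V2 → ℝ → V2) (H₀ : V2 → V2)
    (hz : ContHolderInTime 1 α E Tt z)
    (hzdiv : ∀ t ∈ Icc (0 : ℝ) Tt, ∀ x ∈ E, div2 (fun y => z y t) x = 0)
    (hztan : ∀ t ∈ Icc (0 : ℝ) Tt, ∀ x ∈ frontier E, dot (z x t) (n x) = 0)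
    (hg : BddHolderInTime 0 α E Tt g)
    (hH₀ : HolderClass 1 α (closure E) H₀)
    (hH : ContHolderInTime 1 α E Tt H)
    (heq : ∀ x ∈ E, ∀ t ∈ Ioo (0 : ℝ) Tt,
      HasDerivAt (fun s => H x s)
        (g x t - fderiv ℝ (fun y => H y t) x (z x t)
          + fderiv ℝ (fun y => z y t) x (H x t)) t)
    (hinit : ∀ x ∈ closure E, H x 0 = H₀ x)
    (Z : V2 → ℝ → ℝ → V2) (hflow : IsFlowOf z Z)
    (hinv : ∀ x ∈ closure E, ∀ s t : ℝ, Z x s t ∈ closure E) :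
    ∀ t ∈ Icc (0 : ℝ) Tt, ∀ x ∈ closure E, H x t ≠ 0 →
      x ∈ (fun y => Z y 0 t) '' tsupport H₀ ∪
        ⋃ s ∈ Icc (0 : ℝ) t, (fun y => Z y s t) '' tsupport (fun y => g y s) := by
  intro t ht x hx hne
  by_contra hcon
  simp only [mem_union, mem_iUnion, not_or, not_exists] at hcon
  obtain ⟨hcon₀, hcong⟩ := hcon
  have hEc : IsCompact (closure E) := hEb.isCompact_closure
  have hDz := hz.continuousOn_fderiv hEc
  obtain ⟨M, hM⟩ := (hEc.prod isCompact_Icc).exists_bound_of_continuousOn hDz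
  set γ : ℝ → V2 := fun r => Z x t r
  have hγd : ∀ r, HasDerivAt γ (z (γ r) r) r := fun r => hflow.2 x t r
  have hγK : ∀ r, γ r ∈ closure E := fun r => hinv x hx t r
  have hγt : γ t = x := hflow.1 x t
  have hback : ∀ s ∈ Icc 0 t, Z (γ s) s t = x := fun s hs => by
    rw [← hγt]
    exact trajectory_unique isClosed_closure (fun r hr => (hz.1 r hr).1)
      (fun r hr y hy => hM (y, r) ⟨hy, hr⟩) (hz.continuousOn hEc) hflow hinv
      (fun r => hflow.2 (γ s) s r) hγd (fun r => hinv _ (hγK s) s r) hγK hs.1 ht.2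
      (hflow.1 _ _) t ⟨hs.2, le_rfl⟩
  have hg0 : ∀ s ∈ Icc 0 t, g (γ s) s = 0 := fun s hs =>
    image_eq_zero_of_notMem_tsupport (f := fun y => g y s) fun h =>
      hcong s hs ⟨γ s, h, hback s hs⟩
  have hH0 : H (γ 0) 0 = 0 := by
    rw [hinit _ (hγK 0)]
    exact image_eq_zero_of_notMem_tsupport fun h => hcon₀ ⟨γ 0, h, hback 0 ⟨le_rfl, ht.1⟩⟩
  have hxt : H (γ t) t ≠ 0 := by rwa [hγt]
  rcases ht.1.eq_or_lt with rfl | ht0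
  · exact hxt hH0
  obtain ⟨hgH, C, hC⟩ := hg
  have hgC : ∀ s ∈ Ioo (0 : ℝ) Tt, ∀ x ∈ closure E, ∀ y ∈ closure E,
      ‖g x s - g y s‖ ≤ C * ‖x - y‖ ^ α := by
    intro s hs x hx y hy
    rcases eq_or_ne x y with rfl | hxy
    · simp [Real.zero_rpow hα.1.ne']
    · exact (norm_sub_le_hNorm_mul_rpow (hgH s hs) hx hy hxy).trans
        (mul_le_mul_of_nonneg_right (hC s hs) (by positivity))
  refine hxt (eq_zero_of_norm_deriv_right_le (f := fun s => H (γ s) s) (M := M) ht0 ?_ hH0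
    (fun s hs => hasDerivWithinAt_along_trajectory hEc hα.1 hz hH hgC heq hγd hγK ht.2 hg0 hs)
    fun s hs => ?_)
  · have hγc : Continuous γ := continuous_iff_continuousAt.2 fun r => (hγd r).continuousAt
    exact (hH.continuousOn hEc).comp (f := fun s => (γ s, s)) (by fun_prop)
      fun s hs => ⟨hγK s, hs.1, hs.2.trans ht.2⟩
  · exact ContinuousLinearMap.le_of_opNorm_le _
      (hM (γ s, s) ⟨hγK s, hs.1.le, hs.2.le.trans ht.2⟩) _
end
end

section
/- Let z^+ = (z^+_1, z^+_2) and z^− = (z^−_1, z^−_2) be differentiable divergence-free vector fields on an open set of ℝ², and let y* = (y*_1, y*_2) be any differentiable vector field. Define G^±(z^+, z^−) := − Σ_{l=1}^{2} ∇z^∓_l ∧ ∂_l z^±, where a ∧ b := a₁b₂ − a₂b₁ for planar vectors. Then pointwise G^±(z^+, z^−) = −∂₁(z^∓_1 − z^±_1)(∂₁z^±_2 + ∂₂z^±_1) − ∂₁(z^±_2 − z^∓_2)∂₁z^±_1 − ∂₂(z^±_1 − z^∓_1)∂₁z^±_1, and consequently also G^±(z^+, z^−) = −∂₁(z^∓_1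 − y*_1)(∂₁z^±_2 + ∂₂z^±_1) − ∂₁(y*_1 − z^±_1)(∂₁z^±_2 + ∂₂z^±_1) − ∂₁(z^±_2 − y*_2)∂₁z^±_1 − ∂₁(y*_2 − z^∓_2)∂₁z^±_1 − ∂₂(z^±_1 − y*_1)∂₁z^±_1 − ∂₂(y*_1 − z^∓_1)∂₁z^±_1. -/
open Set Filter MeasureTheory Topology

noncomputable section

/-- Partial derivative `∂_l f_i` of a planar vector field. -/
def Dpart (f : V2 → V2) (x : V2) (l i : Fin 2) : ℝ := fderiv ℝ f x (ebasis l) i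

/-- The nonlinearity `G^±(z^+, z^-) = -∑_l ∇ b_l ∧ ∂_l a` appearing in the curled
Elsasser equations (`a` is the `±` field, `b` the `∓` field). -/
def Gop (a b : V2 → V2) (x : V2) : ℝ :=
  -∑ l : Fin 2, (Dpart b x 0 l * Dpart a x l 1 - Dpart b x 1 l * Dpart a x l 0)

/-- identity (reprGpm) in Section 3.4.1: for divergence-free fields,
the nonlinearity `G^±` has the stated pointwise representations, also relative to any
reference field `y*`.  (Indices are 0-based: paper's `∂₁, ∂₂` are `∂_0, ∂_1` and
components `z_1, z_2` are `z_0, z_1`.) -/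
theorem G_representation
    (U : Set V2) (hU : IsOpen U) (a b ys : V2 → V2)
    (ha : ∀ x ∈ U, DifferentiableAt ℝ a x)
    (hb : ∀ x ∈ U, DifferentiableAt ℝ b x)
    (hys : ∀ x ∈ U, DifferentiableAt ℝ ys x)
    (hadiv : ∀ x ∈ U, div2 a x = 0)
    (hbdiv : ∀ x ∈ U, div2 b x = 0) :
    ∀ x ∈ U,
      Gop a b x =
        -(Dpart b x 0 0 - Dpart a x 0 0) * (Dpart a x 0 1 + Dpart a x 1 0)
          - (Dpart a x 0 1 - Dpart b x 0 1) * Dpart a x 0 0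
          - (Dpart a x 1 0 - Dpart b x 1 0) * Dpart a x 0 0 ∧
      Gop a b x =
        -(Dpart b x 0 0 - Dpart ys x 0 0) * (Dpart a x 0 1 + Dpart a x 1 0)
          - (Dpart ys x 0 0 - Dpart a x 0 0) * (Dpart a x 0 1 + Dpart a x 1 0)
          - (Dpart a x 0 1 - Dpart ys x 0 1) * Dpart a x 0 0
          - (Dpart ys x 0 1 - Dpart b x 0 1) * Dpart a x 0 0
          - (Dpart a x 1 0 - Dpart ys x 1 0) * Dpart a x 0 0
          - (Dpart ys x 1 0 - Dpart b x 1 0) * Dpart a x 0 0 := by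
  intro x hx
  have h := hadiv x hx
  have h' := hbdiv x hx
  simp only [div2, Fin.sum_univ_two] at h h'
  have ha11 : Dpart a x 1 1 = -Dpart a x 0 0 := eq_neg_of_add_eq_zero_right h
  have hb11 : Dpart b x 1 1 = -Dpart b x 0 0 := eq_neg_of_add_eq_zero_right h'
  simp only [Gop, Fin.sum_univ_two, ha11, hb11]
  constructor <;> ring
end
end
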